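/- arXiv:1112.3982 — 3 statements merged into one kernel-verified Lean document; each statement's English description precedes it below -/
import Mathlib

section
/- Let F be an absolutely continuous cumulative distribution function on the real line such that F'(x) = F(x)(1 − F(x)) for all x in (l_F, r_F), where l_F = inf{x : F(x) > 0} and r_F = sup{x : F(x) < 1}. Then there exists a real constant μ such that F(x) = (1 + e^{−(x−μ)})^{−1} for all real x; that is, F is a logistic distribution function with location parameter μ. -/
open MeasureTheory

/-- If an absolutely continuous cumulative distribution function `F` satisfies the
differential equation `F' = F(1 - F)` on the interior of its support, then `F` is a
logistic distribution function with some location parameter `μ`. -/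
theorem cdf_ode_implies_logistic
    (F : ℝ → ℝ) (μ : Measure ℝ) [IsProbabilityMeasure μ]
    -- `F` is the c.d.f. of a distribution absolutely continuous w.r.t. Lebesgue measure
    (hac : μ ≪ volume)
    (hF : ∀ x, F x = (μ (Set.Iic x)).toReal)
    -- `F' = F(1 - F)` on `(l_F, r_F)`, i.e. at every point where `0 < F < 1`
    (hode : ∀ x, 0 < F x → F x < 1 → HasDerivAt F (F x * (1 - F x)) x) :
    ∃ m : ℝ, ∀ x, F x = (1 + Real.exp (-(x - m)))⁻¹ := by
  have hFc : ∀ x, F x = ProbabilityTheory.cdf μ x := by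
    intro x
    rw [hF, ProbabilityTheory.cdf_eq_real]; rfl
  have hFe : F = ⇑(ProbabilityTheory.cdf μ) := funext hFc
  have hcont : Continuous F := by
    rw [hFe, continuous_iff_continuousAt]
    intro x
    rw [(ProbabilityTheory.monotone_cdf μ).continuousAt_iff_leftLim_eq_rightLim,
      StieltjesFunction.rightLim_eq]
    have h0 : μ {x} = 0 := hac (by simp)
    rw [← ProbabilityTheory.measure_cdf μ, StieltjesFunction.measure_singleton,
      ENNReal.ofReal_eq_zero] at h0
    have h1 := (ProbabilityTheory.monotone_cdf μ).leftLim_le (le_refl x)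
    linarith
  have hbot : Filter.Tendsto F Filter.atBot (nhds 0) := by
    rw [hFe]; exact ProbabilityTheory.tendsto_cdf_atBot μ
  have htop : Filter.Tendsto F Filter.atTop (nhds 1) := by
    rw [hFe]; exact ProbabilityTheory.tendsto_cdf_atTop μ
  obtain ⟨m, hm⟩ : ∃ m, F m = 1 / 2 := by
    obtain ⟨a, ha⟩ := (hbot.eventually (gt_mem_nhds (show (0:ℝ) < 1/2 by norm_num))).exists
    obtain ⟨b, hb⟩ := (htop.eventually (lt_mem_nhds (show (1/2:ℝ) < 1 by norm_num))).exists
    exact mem_range_of_exists_le_of_exists_ge hcont ⟨a, ha.le⟩ ⟨b, hb.le⟩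
  refine ⟨m, ?_⟩
  have hiff : ∀ y, 0 < F y → F y < 1 →
      (F y = (1 + Real.exp (-(y - m)))⁻¹ ↔ F y / (1 - F y) * Real.exp (-y) = Real.exp (-m)) := by
    intro y h0 h1
    have e : Real.exp (-(y - m)) = Real.exp (-y) / Real.exp (-m) := by
      rw [← Real.exp_sub]; congr 1; ring
    have p1 := Real.exp_pos (-y)
    have p2 := Real.exp_pos (-m)
    have h2 : (1 - F y) ≠ 0 := by linarith
    rw [e]
    have h3 : 1 + Real.exp (-y) / Real.exp (-m) ≠ 0 := by positivity
    rw [← mul_eq_one_iff_eq_inv₀ h3]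
    field_simp
    constructor <;> intro h <;> linarith
  have hL : Continuous (fun x : ℝ => (1 + Real.exp (-(x - m)))⁻¹) := by
    apply Continuous.inv₀ (by fun_prop)
    intro x; positivity
  have hclopen : IsClopen {x | F x = (1 + Real.exp (-(x - m)))⁻¹} := by
    refine ⟨isClosed_eq hcont hL, ?_⟩
    rw [Metric.isOpen_iff]
    intro x hx
    have hx' : F x = (1 + Real.exp (-(x - m)))⁻¹ := hx
    have hp := Real.exp_pos (-(x - m))
    have hx0 : 0 < F x := by rw [hx']; positivity
    have hx1 : F x < 1 := by rw [hx']; exact inv_lt_one_of_one_lt₀ (by linarith)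
    have hU : IsOpen (F ⁻¹' Set.Ioo 0 1) := isOpen_Ioo.preimage hcont
    obtain ⟨ε, hε, hb⟩ := Metric.isOpen_iff.1 hU x ⟨hx0, hx1⟩
    refine ⟨ε, hε, ?_⟩
    have hd : ∀ y ∈ Metric.ball x ε,
        HasDerivAt (fun y => F y / (1 - F y) * Real.exp (-y)) 0 y := by
      intro y hy
      obtain ⟨h0, h1⟩ := hb hy
      have h2 : (1 - F y) ≠ 0 := by linarith
      have hf := hode y h0 h1
      have := (hf.div (hf.const_sub 1) h2).mul ((hasDerivAt_neg y).exp)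
      refine HasDerivAt.congr_deriv (f := fun y => F y / (1 - F y) * Real.exp (-y)) this ?_
      simp only [Pi.div_apply]
      field_simp
      ring
    intro y hy
    have hc := Metric.isOpen_ball.is_const_of_deriv_eq_zero
      (convex_ball x ε).isPreconnected
      (fun y hy => (hd y hy).differentiableAt.differentiableWithinAt)
      (fun y hy => (hd y hy).deriv) hy (Metric.mem_ball_self hε)
    obtain ⟨h0, h1⟩ := hb hy
    exact (hiff y h0 h1).2 (hc.trans ((hiff x hx0 hx1).1 hx'))
  have huniv := hclopen.eq_univ ⟨m, by simp [hm]; norm_num⟩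
  intro x
  exact (Set.eq_univ_iff_forall.1 huniv) x
end

section
/- Let 𝓒 = 𝓒[0,∞) be the space of real-valued continuous functions on [0,∞), let 𝓔 ⊂ 𝓒, and let A be an intensively monotone operator mapping 𝓔 into 𝓒. Let {f_λ}_{λ∈Λ} be a strongly 𝓔-positive family of elements of 𝓔, and assume A f_λ = f_λ for all λ ∈ Λ. Then for any f ∈ 𝓔 with A f = f, there exists λ ∈ Λ such that f = f_λ; i.e., every fixed point of A in 𝓔 coincides with a member of the family {f_λ}_{λ∈Λ}. -/
theorem aux_no_touch (g h : ℝ → ℝ) (hg : ContinuousOn g (Set.Ici 0))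
    (hh : ContinuousOn h (Set.Ici 0))
    (H : ∀ t > (0 : ℝ), (∀ τ ∈ Set.Ioo (0 : ℝ) t, h τ < g τ) → h t < g t)
    (δ : ℝ) (hδ : 0 < δ) (hlt : ∀ t ∈ Set.Ioc (0 : ℝ) δ, h t < g t)
    (t₀ : ℝ) (ht₀ : 0 < t₀) : h t₀ < g t₀ := by
  by_contra hc
  push Not at hc
  have hsub : Set.Icc δ t₀ ⊆ Set.Ici 0 := fun x hx => hδ.le.trans hx.1
  have hδt : δ ≤ t₀ := by
    by_contra hlt'
    push Not at hlt'
    exact absurd (hlt t₀ ⟨ht₀, hlt'.le⟩) (not_lt.mpr hc)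
  have hclosed : IsClosed {x | x ∈ Set.Icc δ t₀ ∧ g x ≤ h x} :=
    isClosed_Icc.isClosed_le (hg.mono hsub) (hh.mono hsub)
  have hcomp : IsCompact {x | x ∈ Set.Icc δ t₀ ∧ g x ≤ h x} :=
    isCompact_Icc.of_isClosed_subset hclosed (fun x hx => hx.1)
  obtain ⟨s, hs, hmin⟩ := hcomp.exists_isLeast ⟨t₀, ⟨hδt, le_rfl⟩, hc⟩
  refine absurd (H s (hδ.trans_le hs.1.1) ?_) (not_lt.mpr hs.2)
  intro τ hτ
  by_contra hn
  push Not at hn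
  rcases le_total τ δ with h1 | h1
  · exact absurd (hlt τ ⟨hτ.1, h1⟩) (not_lt.mpr hn)
  · exact absurd (hmin ⟨⟨h1, hτ.2.le.trans hs.1.2⟩, hn⟩) (not_le.mpr hτ.2)

/-- Kakosyan–Klebanov–Melamed fixed point theorem (Lemma 2 of the paper): every fixed
point in `𝓔` of an intensively monotone operator coincides with a member of a strongly
`𝓔`-positive family of fixed points.  Functions are real-valued functions on `ℝ`
regarded as elements of `C[0, ∞)`. -/
theorem intensively_monotone_fixed_point
    (E : Set (ℝ → ℝ))
    -- elements of `𝓔 ⊆ 𝓒[0,∞)` are continuous on `[0, ∞)`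
    (hEcont : ∀ f ∈ E, ContinuousOn f (Set.Ici 0))
    (A : (ℝ → ℝ) → (ℝ → ℝ))
    -- `A` is intensively monotone on `𝓔`:
    (hA₁ : ∀ f₁ ∈ E, ∀ f₂ ∈ E, ∀ t > (0 : ℝ),
      (∀ τ ∈ Set.Ioo (0 : ℝ) t, f₂ τ ≤ f₁ τ) →
        ∀ τ ∈ Set.Ioo (0 : ℝ) t, A f₂ τ ≤ A f₁ τ)
    (hA₂ : ∀ f₁ ∈ E, ∀ f₂ ∈ E, ∀ t > (0 : ℝ),
      (∀ τ ∈ Set.Ioo (0 : ℝ) t, f₂ τ < f₁ τ) → A f₂ t < A f₁ t)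
    -- `{f_λ}_{λ ∈ Λ}` is a family of elements of `𝓔` ...
    (Λ : Type*) (fl : Λ → ℝ → ℝ) (hfl : ∀ l, fl l ∈ E)
    -- ... which is strongly `𝓔`-positive:
    (hpos₁ : ∀ f ∈ E, ∃ t₀ > (0 : ℝ), ∃ l : Λ, f t₀ = fl l t₀)
    (hpos₂ : ∀ f ∈ E, ∀ l : Λ,
      (∀ t ∈ Set.Ici (0 : ℝ), f t = fl l t) ∨
        ∃ δ > (0 : ℝ),
          (∀ t ∈ Set.Ioc (0 : ℝ) δ, fl l t < f t) ∨
          (∀ t ∈ Set.Ioc (0 : ℝ) δ, f t < fl l t))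
    -- each `f_λ` is a fixed point of `A`
    (hfix : ∀ l : Λ, ∀ t ∈ Set.Ici (0 : ℝ), A (fl l) t = fl l t)
    -- then any fixed point of `A` in `𝓔` coincides with some `f_λ`
    (f : ℝ → ℝ) (hf : f ∈ E) (hAf : ∀ t ∈ Set.Ici (0 : ℝ), A f t = f t) :
    ∃ l : Λ, ∀ t ∈ Set.Ici (0 : ℝ), f t = fl l t := by
  obtain ⟨t₀, ht₀, l, hl⟩ := hpos₁ f hf
  refine ⟨l, ?_⟩
  rcases hpos₂ f hf l with h | ⟨δ, hδ, h | h⟩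
  · exact h
  · have := aux_no_touch f (fl l) (hEcont f hf) (hEcont _ (hfl l))
      (fun t ht hlt => by
        have := hA₂ f hf _ (hfl l) t ht hlt
        rwa [hfix l t (le_of_lt ht), hAf t (le_of_lt ht)] at this) δ hδ h t₀ ht₀
    exact absurd hl this.ne'
  · have := aux_no_touch (fl l) f (hEcont _ (hfl l)) (hEcont f hf)
      (fun t ht hlt => by
        have := hA₂ _ (hfl l) f hf t ht hlt
        rwa [hfix l t (le_of_lt ht), hAf t (le_of_lt ht)] at this) δ hδ h t₀ ht₀
    exact absurd hl this.ne
end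

section
/- Let X_1,...,X_n be independent copies of a random variable X with absolutely continuous cumulative distribution function F having density F' that is positive on (l_F, r_F), where l_F = inf{x : F(x) > 0} and r_F = sup{x : F(x) < 1}, and let w(x) = F'(x)/(F(x)(1−F(x))) for x ∈ (l_F, r_F). Suppose F(x) ≠ 1/2 for all x ≠ 0, F(0) = 1/2, and that the differential equation (2F−1)w' = [(2nF−n−1)Fw − (n−1)F − 1](w−1) − k(2F−1)(w−1)² holds on (l_F, r_F) for two distinct integer values k = k_1 and k = k_2 in [1, n−2]. Then w(x) = 1 for all x ∈ (l_F, r_F), i.e., F'(x) = F(x)(1−F(x)) on (l_F, r_F), and consequently F is the standard logistic distribution function F_L(x)=e^x/(1+e^x). -/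
open MeasureTheory

/-- The standard logistic cumulative distribution function. -/
noncomputable def stdLogisticCDF (x : ℝ) : ℝ := Real.exp x / (1 + Real.exp x)

theorem aux_logistic (F : ℝ → ℝ) (hc : Continuous F) (hF0 : F 0 = 1 / 2)
    (hd : ∀ x, 0 < F x → F x < 1 → HasDerivAt F (F x * (1 - F x)) x) :
    ∀ x, F x = stdLogisticCDF x := by
  have hL : Continuous stdLogisticCDF := by
    unfold stdLogisticCDF
    exact Real.continuous_exp.div (by fun_prop) (fun x => by positivity)
  have hcl : IsClosed {x | F x = stdLogisticCDF x} := isClosed_eq hc hL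
  have hop : IsOpen {x | F x = stdLogisticCDF x} := by
    rw [Metric.isOpen_iff]
    intro x hx
    have hx' : F x = Real.exp x / (1 + Real.exp x) := hx
    have e0 := Real.exp_pos x
    have h0 : 0 < F x := by rw [hx']; positivity
    have h1 : F x < 1 := by rw [hx', div_lt_one (by positivity)]; linarith
    have hS : IsOpen {y | 0 < F y ∧ F y < 1} :=
      (isOpen_lt continuous_const hc).inter (isOpen_lt hc continuous_const)
    obtain ⟨ε, hε, hb⟩ := Metric.isOpen_iff.1 hS x ⟨h0, h1⟩
    refine ⟨ε, hε, fun y hy => ?_⟩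
    have hder : ∀ z ∈ Metric.ball x ε,
        HasDerivAt (fun t => F t * Real.exp (-t) / (1 - F t)) 0 z := by
      intro z hz
      obtain ⟨z0, z1⟩ := hb hz
      have hne : 1 - F z ≠ 0 := by linarith
      have a := hd z z0 z1
      have b : HasDerivAt (fun t : ℝ => Real.exp (-t)) (Real.exp (-z) * (-1)) z :=
        (hasDerivAt_neg z).exp
      have c := (a.mul b).div (a.const_sub 1) hne
      refine c.congr_deriv ?_
      rw [div_eq_zero_iff]
      left
      simp only [Pi.mul_apply]
      ring
    have key := (convex_ball x ε).is_const_of_fderivWithin_eq_zero (𝕜 := ℝ)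
      (f := fun t => F t * Real.exp (-t) / (1 - F t))
      (fun z hz => (hder z hz).differentiableAt.differentiableWithinAt)
      (fun z hz => by
        rw [fderivWithin_of_isOpen Metric.isOpen_ball hz]
        have := (hder z hz).hasFDerivAt.fderiv
        rw [this]; ext; simp) (Metric.mem_ball_self hε) hy
    obtain ⟨y0, y1⟩ := hb hy
    have hxv : F x * Real.exp (-x) / (1 - F x) = 1 := by
      rw [hx', Real.exp_neg]
      have : 1 - Real.exp x / (1 + Real.exp x) = 1 / (1 + Real.exp x) := by
        field_simp; ring
      rw [this]; field_simp
    rw [hxv] at key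
    have hne : 1 - F y ≠ 0 := by linarith
    have ey := Real.exp_pos y
    rw [Real.exp_neg, eq_div_iff hne] at key
    show F y = Real.exp y / (1 + Real.exp y)
    field_simp at key ⊢
    linarith
  have hu := IsClopen.eq_univ ⟨hcl, hop⟩ ⟨0, by
    show F 0 = Real.exp 0 / (1 + Real.exp 0)
    rw [hF0]; norm_num⟩
  intro x
  have : x ∈ {x | F x = stdLogisticCDF x} := hu ▸ Set.mem_univ x
  exact this

theorem aux_cont (μ : Measure ℝ) [IsProbabilityMeasure μ] (hac : μ ≪ volume)
    (F : ℝ → ℝ) (hF : ∀ x, F x = (μ (Set.Iic x)).toReal) : Continuous F := by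
  have hFc : F = ProbabilityTheory.cdf μ := by
    ext x; rw [hF, ProbabilityTheory.cdf_eq_real]; rfl
  rw [hFc, continuous_iff_continuousAt]
  intro x
  rw [(ProbabilityTheory.cdf μ).mono.continuousAt_iff_leftLim_eq_rightLim,
    StieltjesFunction.rightLim_eq]
  have h : (ProbabilityTheory.cdf μ).measure {x} = 0 := by
    rw [ProbabilityTheory.measure_cdf]
    exact hac (by simp)
  rw [StieltjesFunction.measure_singleton, ENNReal.ofReal_eq_zero] at h
  have := (ProbabilityTheory.cdf μ).mono.leftLim_le (le_refl x)
  linarith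

/-- Uniqueness for the differential equation arising in the case `r = 2` of Theorem 1:
if `w = F' / (F(1-F))` satisfies the quadratic Riccati-type equation for two distinct
admissible values of `k`, then `w ≡ 1` on the support, i.e. `F' = F(1-F)`, and `F` is
the standard logistic distribution function. -/
theorem ode_uniqueness_two_values_implies_logistic
    (n k₁ k₂ : ℕ) (hk₁ : 1 ≤ k₁) (hk₁n : k₁ ≤ n - 2)
    (hk₂ : 1 ≤ k₂) (hk₂n : k₂ ≤ n - 2) (hne : k₁ ≠ k₂)
    (μ : Measure ℝ) [IsProbabilityMeasure μ]
    -- `F` is the c.d.f. of a distribution absolutely continuous w.r.t. Lebesgue measure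
    (hac : μ ≪ volume)
    (F f : ℝ → ℝ) (hF : ∀ x, F x = (μ (Set.Iic x)).toReal)
    -- with density `f = F'` which is positive on `(l_F, r_F)`
    (hf : ∀ x, 0 < F x → F x < 1 → HasDerivAt F (f x) x)
    (hfpos : ∀ x, 0 < F x → F x < 1 → 0 < f x)
    (hF0 : F 0 = 1 / 2) (hFne : ∀ x : ℝ, x ≠ 0 → F x ≠ 1 / 2)
    (w : ℝ → ℝ) (hw : ∀ x, w x = f x / (F x * (1 - F x)))
    -- the differential equation holds on `(l_F, r_F)` for `k = k₁` and `k = k₂`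
    (hode : ∀ k : ℕ, k = k₁ ∨ k = k₂ → ∀ x, 0 < F x → F x < 1 →
      (2 * F x - 1) * deriv w x =
        ((2 * n * F x - n - 1) * F x * w x - (n - 1) * F x - 1) * (w x - 1)
          - k * (2 * F x - 1) * (w x - 1) ^ 2) :
    (∀ x, 0 < F x → F x < 1 → w x = 1 ∧ f x = F x * (1 - F x)) ∧
      ∀ x, F x = stdLogisticCDF x := by
  have hmain : ∀ x, 0 < F x → F x < 1 → w x = 1 ∧ f x = F x * (1 - F x) := by
    intro x h0 h1
    have hp : 0 < F x * (1 - F x) := mul_pos h0 (by linarith)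
    have hwpos : 0 < w x := by rw [hw]; exact div_pos (hfpos x h0 h1) hp
    have e1 := hode k₁ (Or.inl rfl) x h0 h1
    have e2 := hode k₂ (Or.inr rfl) x h0 h1
    have hw1 : w x = 1 := by
      by_cases hx : x = 0
      · subst hx
        rw [hF0] at e1
        have hn : (0 : ℝ) ≤ n := Nat.cast_nonneg n
        have : (w 0 + n + 1) * (w 0 - 1) = 0 := by linear_combination (2 : ℝ) * e1
        rcases mul_eq_zero.1 this with h | h <;> linarith
      · have hk : ((k₁ : ℝ) - k₂) ≠ 0 := sub_ne_zero.2 (by exact_mod_cast hne)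
        have h2 : 2 * F x - 1 ≠ 0 := fun h => hFne x hx (by linarith)
        have : (((k₁ : ℝ) - k₂) * (2 * F x - 1)) * (w x - 1) ^ 2 = 0 := by
          linear_combination e1 - e2
        have := (mul_eq_zero.1 this).resolve_left (mul_ne_zero hk h2)
        have := pow_eq_zero_iff (two_ne_zero) |>.1 this
        linarith
    refine ⟨hw1, ?_⟩
    rw [hw, div_eq_one_iff_eq hp.ne'] at hw1
    exact hw1
  refine ⟨hmain, aux_logistic F (aux_cont μ hac F hF) hF0 fun x h0 h1 => ?_⟩
  rw [← (hmain x h0 h1).2]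
  exact hf x h0 h1
end
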